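/- arXiv:math/0701553 — 2 statements merged into one kernel-verified Lean document; each statement's English description precedes it below -/
import Mathlib

section
/- For k ≥ 2, lim sup_{n→∞} (log SP(n,k))/n = log(k/(k−1)) + (log(k−1))/k, where SP(n,k) is the maximum cardinality of a Sperner k-partition system of an n-set. -/
open Filter

/-- `SP(n,k)`: the maximum cardinality of a Sperner `k`-partition system of an
`n`-set, i.e., a family of `k`-partitions such that for distinct members no class
of one is contained in a class of the other. -/
noncomputable def SP (n k : ℕ) : ℕ :=
  sSup {m | ∃ Ps : Finset (Finpartition (Finset.univ : Finset (Fin n))),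
    (∀ P ∈ Ps, P.parts.card = k) ∧
    (∀ P ∈ Ps, ∀ Q ∈ Ps, P ≠ Q →
      ∀ A ∈ P.parts, ∀ B ∈ Q.parts, ¬ A ⊆ B ∧ ¬ B ⊆ A) ∧
    Ps.card = m}


lemma greedy_aux {X : Type*} [Fintype X] [DecidableEq X] (r : X → X → Prop) [DecidableRel r]
    (hrefl : ∀ x, r x x) (hsymm : ∀ x y, r x y → r y x) (D : ℕ)
    (hD : ∀ x, (Finset.univ.filter (fun y => r x y)).card ≤ D) :
    ∃ S : Finset X, (∀ x ∈ S, ∀ y ∈ S, x ≠ y → ¬ r x y) ∧ Fintype.card X ≤ S.card * D := by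
  classical
  obtain ⟨S, hS, hmax⟩ := Finset.exists_max_image
    (Finset.univ.filter (fun S : Finset X => ∀ x ∈ S, ∀ y ∈ S, x ≠ y → ¬ r x y))
    Finset.card ⟨∅, by simp⟩
  simp only [Finset.mem_filter, Finset.mem_univ, true_and] at hS hmax
  refine ⟨S, hS, ?_⟩
  have hcov : (Finset.univ : Finset X) ⊆ S.biUnion (fun x => Finset.univ.filter (fun y => r x y)) := by
    intro z _
    simp only [Finset.mem_biUnion, Finset.mem_filter, Finset.mem_univ, true_and]
    by_contra! hz
    have hzS : z ∉ S := fun h => hz z h (hrefl z)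
    have := hmax (insert z S) (by
      intro x hx y hy hxy
      rw [Finset.mem_insert] at hx hy
      rcases hx with rfl | hx <;> rcases hy with rfl | hy
      · exact absurd rfl hxy
      · exact fun h => hz y hy (hsymm _ _ h)
      · exact hz x hx
      · exact hS x hx y hy hxy)
    rw [Finset.card_insert_of_notMem hzS] at this
    omega
  calc Fintype.card X = (Finset.univ : Finset X).card := rfl
    _ ≤ _ := Finset.card_le_card hcov
    _ ≤ S.card * D := Finset.card_biUnion_le_card_mul _ _ _ (fun x _ => hD x)

lemma perm_count (n c : ℕ) (A B : Finset (Fin n)) (hA : A.card = c) :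
    (Finset.univ.filter (fun τ : Equiv.Perm (Fin n) => B.map τ.toEmbedding = A)).card * n.choose c
      ≤ n.factorial := by
  classical
  have hg : ∀ A' : Finset (Fin n), ∃ g : Equiv.Perm (Fin n), A'.card = c →
      A.map g.toEmbedding = A' := by
    intro A'
    by_cases h : A'.card = c
    · obtain ⟨g, hg⟩ := Equiv.Perm.exists_map_finset_eq A A' (hA.trans h.symm)
      exact ⟨g, fun _ => hg⟩
    · exact ⟨1, fun h' => absurd h' h⟩
  choose g hg using hg
  have h1 : n.choose c = (Finset.powersetCard c (Finset.univ : Finset (Fin n))).card := by simp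
  have h2 : n.factorial = (Finset.univ : Finset (Equiv.Perm (Fin n))).card := by
    rw [Finset.card_univ, Fintype.card_perm, Fintype.card_fin]
  rw [h1, h2, ← Finset.card_product]
  apply Finset.card_le_card_of_injOn (fun p => p.1.trans (g p.2)) (by simp)
  rintro ⟨τ, A1⟩ h1 ⟨τ', A2⟩ h2 heq
  simp only [Finset.coe_product, Set.mem_prod, Finset.mem_coe, Finset.mem_filter, Finset.mem_univ,
    true_and, Finset.mem_powersetCard, Finset.subset_univ] at h1 h2 heq
  have key : ∀ (τ : Equiv.Perm (Fin n)) (A1 : Finset (Fin n)), B.map τ.toEmbedding = A →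
      A1.card = c → B.map (τ.trans (g A1)).toEmbedding = A1 := by
    intro τ A1 h h'
    rw [Equiv.trans_toEmbedding, ← Finset.map_map, h, hg A1 h']
  have hAA : A1 = A2 := by
    rw [← key τ A1 h1.1 h1.2, heq, key τ' A2 h2.1 h2.2]
  subst hAA
  have : τ = τ' := by
    ext x
    have := congrArg (fun e : Equiv.Perm (Fin n) => e x) heq
    simp at this
    rw [this]
  rw [this]

lemma exists_P0 (k c : ℕ) (hk : 2 ≤ k) (hc : 1 ≤ c) :
    ∃ P : Finpartition (Finset.univ : Finset (Fin (c * k))), P.parts.card = k ∧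
      ∀ A ∈ P.parts, A.card = c := by
  obtain ⟨P, hP, hPk⟩ := Finpartition.exists_equipartition_card_eq
    (Finset.univ : Finset (Fin (c * k))) (n := k) (by omega) (by simp; nlinarith)
  refine ⟨P, hPk, ?_⟩
  have hge : ∀ A ∈ P.parts, c ≤ A.card := by
    intro A hA
    have := hP.average_le_card_part hA
    rw [hPk, Finset.card_univ, Fintype.card_fin, Nat.mul_div_cancel _ (by omega)] at this
    exact this
  have hsum := P.sum_card_parts
  have h2 : ∑ A ∈ P.parts, c = ∑ A ∈ P.parts, A.card := by
    rw [hsum]; simp [hPk, mul_comm]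
  intro A hA
  exact ((Finset.sum_eq_sum_iff_of_le hge).1 h2 A hA).symm

lemma exists_map_part {n : ℕ} (P : Finpartition (Finset.univ : Finset (Fin n)))
    (σ : Equiv.Perm (Fin n)) :
    ∃ Q : Finpartition (Finset.univ : Finset (Fin n)), Q.parts.card = P.parts.card ∧
      ∀ A, A ∈ Q.parts ↔ ∃ B ∈ P.parts, B.map σ.toEmbedding = A := by
  let e : Finset (Fin n) ≃o Finset (Fin n) :=
    { toEquiv := Equiv.finsetCongr σ
      map_rel_iff' := by intro a b; simp [Equiv.finsetCongr] }
  have he : e Finset.univ = Finset.univ := by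
    simp [e]
  refine ⟨(P.map e).copy he, ?_, ?_⟩
  · simp
  · intro A
    simp only [Finpartition.copy_parts, Finpartition.parts_map, Finset.mem_map]
    rfl

lemma SP_exists_family (k c : ℕ) (hk : 2 ≤ k) (hc : 1 ≤ c) :
    ∃ Ps : Finset (Finpartition (Finset.univ : Finset (Fin (c * k)))),
    (∀ P ∈ Ps, P.parts.card = k) ∧
    (∀ P ∈ Ps, ∀ Q ∈ Ps, P ≠ Q →
      ∀ A ∈ P.parts, ∀ B ∈ Q.parts, ¬ A ⊆ B ∧ ¬ B ⊆ A) ∧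
    (c * k).choose c ≤ Ps.card * k ^ 2 := by
  classical
  obtain ⟨P0, hP0k, hP0c⟩ := exists_P0 k c hk hc
  have hcn : c ≤ c * k := by nlinarith
  generalize c * k = n at P0 hP0k hP0c hcn ⊢
  choose Q hQk hQ using exists_map_part P0
  have hCpos : 0 < n.choose c := Nat.choose_pos hcn
  let r : Equiv.Perm (Fin n) → Equiv.Perm (Fin n) → Prop := fun σ τ =>
    ∃ A ∈ P0.parts, ∃ B ∈ P0.parts, B.map τ.toEmbedding = A.map σ.toEmbedding
  have hne : P0.parts.Nonempty := by
    rw [← Finset.card_pos]; omega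
  obtain ⟨A0, hA0⟩ := hne
  obtain ⟨S, hS, hcard⟩ := greedy_aux r (fun σ => ⟨A0, hA0, A0, hA0, rfl⟩)
    (fun σ τ ⟨A, hA, B, hB, h⟩ => ⟨B, hB, A, hA, h.symm⟩)
    (k ^ 2 * (n.factorial / n.choose c)) (by
      intro σ
      have hsub : Finset.univ.filter (fun τ => r σ τ) ⊆
          (P0.parts ×ˢ P0.parts).biUnion (fun p => Finset.univ.filter
            (fun τ : Equiv.Perm (Fin n) => p.2.map τ.toEmbedding = p.1.map σ.toEmbedding)) := by
        intro τ hτ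
        simp only [Finset.mem_filter, Finset.mem_univ, true_and, r] at hτ
        obtain ⟨A, hA, B, hB, h⟩ := hτ
        simp only [Finset.mem_biUnion, Finset.mem_filter, Finset.mem_univ, true_and]
        exact ⟨(A, B), Finset.mem_product.2 ⟨hA, hB⟩, h⟩
      refine (Finset.card_le_card hsub).trans ?_
      refine (Finset.card_biUnion_le_card_mul _ _ (n.factorial / n.choose c) ?_).trans ?_
      · rintro ⟨A, B⟩ hp
        rw [Finset.mem_product] at hp
        rw [Nat.le_div_iff_mul_le hCpos]
        exact perm_count n c _ _ (by rw [Finset.card_map]; exact hP0c _ hp.1)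
      · rw [Finset.card_product, hP0k, sq])
  have hinj : Set.InjOn Q S := by
    intro σ hσ τ hτ h
    by_contra hne
    apply hS σ hσ τ hτ hne
    have h1 : A0.map σ.toEmbedding ∈ (Q σ).parts := (hQ σ _).2 ⟨A0, hA0, rfl⟩
    rw [h] at h1
    obtain ⟨B, hB, hBe⟩ := (hQ τ _).1 h1
    exact ⟨A0, hA0, B, hB, hBe⟩
  refine ⟨S.image Q, ?_, ?_, ?_⟩
  · intro P hP
    obtain ⟨σ, hσ, rfl⟩ := Finset.mem_image.1 hP
    rw [hQk, hP0k]
  · intro P hP P' hP' hPP A hA B hB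
    obtain ⟨σ, hσ, rfl⟩ := Finset.mem_image.1 hP
    obtain ⟨τ, hτ, rfl⟩ := Finset.mem_image.1 hP'
    have hst : σ ≠ τ := fun h => hPP (by rw [h])
    obtain ⟨A', hA', rfl⟩ := (hQ σ _).1 hA
    obtain ⟨B', hB', rfl⟩ := (hQ τ _).1 hB
    have hnr := hS σ hσ τ hτ hst
    have hca : (A'.map σ.toEmbedding).card = (B'.map τ.toEmbedding).card := by
      rw [Finset.card_map, Finset.card_map, hP0c _ hA', hP0c _ hB']
    constructor
    · intro h
      exact hnr ⟨A', hA', B', hB', (Finset.eq_of_subset_of_card_le h hca.ge).symm⟩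
    · intro h
      exact hnr ⟨A', hA', B', hB', (Finset.eq_of_subset_of_card_le h hca.le)⟩
  · rw [Finset.card_image_of_injOn hinj]
    rw [Fintype.card_perm, Fintype.card_fin] at hcard
    have hdvd : n.choose c * (n.factorial / n.choose c) = n.factorial := by
      apply Nat.mul_div_cancel'
      rw [← Nat.choose_mul_factorial_mul_factorial hcn, mul_assoc]
      exact dvd_mul_right _ _
    have hpos : 0 < n.factorial / n.choose c := by
      rcases Nat.eq_zero_or_pos (n.factorial / n.choose c) with h | h
      · rw [h, mul_zero] at hdvd
        exact absurd hdvd.symm (Nat.factorial_ne_zero n)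
      · exact h
    apply Nat.le_of_mul_le_mul_right _ hpos
    rw [hdvd]
    linarith

lemma choose_term (k c : ℕ) (hk : 2 ≤ k) :
    k ^ (c * k) ≤ (c * k + 1) * ((c * k).choose c * (k - 1) ^ (c * k - c)) := by
  set n := c * k with hn
  obtain ⟨m, rfl⟩ : ∃ m, k = m + 1 := ⟨k - 1, by omega⟩
  simp only [Nat.add_sub_cancel]
  have hm : 1 ≤ m := by omega
  let t : ℕ → ℕ := fun j => n.choose j * m ^ (n - j)
  -- ratio
  have hrat : ∀ j, j < n → t (j + 1) * ((j + 1) * m) = t j * (n - j) := by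
    intro j hj
    have h1 := Nat.choose_succ_right_eq n j
    have h2 : m ^ (n - j) = m ^ (n - (j + 1)) * m := by
      rw [← pow_succ]; congr 1; omega
    simp only [t]
    rw [h2]
    calc _ = (n.choose (j + 1) * (j + 1)) * (m ^ (n - (j + 1)) * m) := by ring
      _ = _ := by rw [h1]; ring
  have hcn : c ≤ n := by nlinarith
  have hup : ∀ d, d ≤ c → t (c - d) ≤ t c := by
    intro d
    induction d with
    | zero => intro _; exact le_rfl
    | succ d ih =>
      intro hd
      refine le_trans ?_ (ih (by omega))
      obtain ⟨j, hj⟩ : ∃ j, c - (d + 1) = j := ⟨_, rfl⟩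
      have hj2 : c - d = j + 1 := by omega
      rw [hj, hj2]
      have hjc : j + 1 ≤ c := by omega
      have hr := hrat j (by omega)
      have hle : (j + 1) * m ≤ n - j := by
        have : (j + 1) * (m + 1) ≤ c * (m + 1) := Nat.mul_le_mul_right _ hjc
        rw [Nat.le_sub_iff_add_le (by omega)]
        nlinarith
      have hpos : 0 < (j + 1) * m := by positivity
      apply Nat.le_of_mul_le_mul_right _ hpos
      rw [hr]
      exact Nat.mul_le_mul_left _ hle
  have hdown : ∀ d, c + d ≤ n → t (c + d) ≤ t c := by
    intro d
    induction d with
    | zero => intro _; exact le_rfl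
    | succ d ih =>
      intro hd
      refine le_trans ?_ (ih (by omega))
      have hr := hrat (c + d) (by omega)
      have hle : n - (c + d) ≤ (c + d + 1) * m := by
        rw [Nat.sub_le_iff_le_add]
        nlinarith [Nat.zero_le (d * m)]
      have hpos : 0 < (c + d + 1) * m := by positivity
      apply Nat.le_of_mul_le_mul_right _ hpos
      rw [← add_assoc, hr]
      exact Nat.mul_le_mul_left _ hle
  have hall : ∀ j ∈ Finset.range (n + 1), t j ≤ t c := by
    intro j hj
    rw [Finset.mem_range] at hj
    rcases le_total j c with h | h
    · have := hup (c - j) (by omega)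
      rwa [Nat.sub_sub_self h] at this
    · have := hdown (j - c) (by omega)
      rwa [Nat.add_sub_cancel' h] at this
  have hb : (m + 1) ^ n = ∑ j ∈ Finset.range (n + 1), t j := by
    rw [add_comm, add_pow]
    apply Finset.sum_congr rfl
    intro j _
    simp [t, mul_comm]
  rw [hb]
  have := Finset.sum_le_card_nsmul _ _ _ hall
  simpa using this

lemma SP_upper_family (n k : ℕ) (hk : 2 ≤ k)
    (Ps : Finset (Finpartition (Finset.univ : Finset (Fin n))))
    (h1 : ∀ P ∈ Ps, P.parts.card = k)
    (h2 : ∀ P ∈ Ps, ∀ Q ∈ Ps, P ≠ Q →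
      ∀ A ∈ P.parts, ∀ B ∈ Q.parts, ¬ A ⊆ B ∧ ¬ B ⊆ A) :
    (Ps.card : ℝ) ≤ Real.exp (n * (Real.log ((k : ℝ) / ((k : ℝ) - 1)) +
      Real.log ((k : ℝ) - 1) / (k : ℝ))) := by
  classical
  have hk' : (2 : ℝ) ≤ k := by exact_mod_cast hk
  have hk1 : (0 : ℝ) < (k : ℝ) - 1 := by linarith
  have hk0 : (0 : ℝ) < (k : ℝ) := by linarith
  have hex : ∀ P : Finpartition (Finset.univ : Finset (Fin n)), ∃ A, P ∈ Ps →
      A ∈ P.parts ∧ k * A.card ≤ n := by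
    intro P
    by_cases hP : P ∈ Ps
    · by_contra! hcon
      have hs := P.sum_card_parts
      have hlt : ∑ A ∈ P.parts, n < ∑ A ∈ P.parts, k * A.card := by
        apply Finset.sum_lt_sum_of_nonempty
        · rw [← Finset.card_pos, h1 P hP]; omega
        · intro A hA
          exact (hcon A).2 hA
      rw [← Finset.mul_sum, hs] at hlt
      simp [h1 P hP] at hlt
    · exact ⟨∅, fun h => absurd h hP⟩
  choose g hg using hex
  have hcard : Ps.card ≤ (Finset.univ.filter (fun A : Finset (Fin n) => k * A.card ≤ n)).card := by
    apply Finset.card_le_card_of_injOn g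
    · intro P hP
      simpa using (hg P hP).2
    · intro P hP Q hQ h
      by_contra hne
      exact (h2 P hP Q hQ hne _ (hg P hP).1 _ (hg Q hQ).1).1 (by rw [h])
  set y := Real.log ((k : ℝ) - 1) with hy
  have hy0 : 0 ≤ y := Real.log_nonneg (by linarith)
  have hterm : ∀ A ∈ Finset.univ.filter (fun A : Finset (Fin n) => k * A.card ≤ n),
      (1 : ℝ) ≤ Real.exp (n * (y / k)) * (((k : ℝ) - 1)⁻¹ ^ A.card * 1 ^ (n - A.card)) := by
    intro A hA
    simp only [Finset.mem_filter, Finset.mem_univ, true_and] at hA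
    have hA' : (k : ℝ) * A.card ≤ n := by exact_mod_cast hA
    have : ((k : ℝ) - 1)⁻¹ = Real.exp (-y) := by
      rw [Real.exp_neg, hy, Real.exp_log hk1]
    rw [this, one_pow, mul_one, ← Real.exp_nat_mul, ← Real.exp_add]
    apply Real.one_le_exp
    have : (A.card : ℝ) ≤ n / k := by
      rw [le_div_iff₀ hk0]; linarith
    have h3 : (n : ℝ) * (y / k) = (n / k) * y := by ring
    rw [h3]
    nlinarith
  calc (Ps.card : ℝ) ≤ ((Finset.univ.filter (fun A : Finset (Fin n) => k * A.card ≤ n)).card : ℝ) := by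
        exact_mod_cast hcard
    _ = ∑ A ∈ Finset.univ.filter (fun A : Finset (Fin n) => k * A.card ≤ n), (1 : ℝ) := by simp
    _ ≤ ∑ A ∈ Finset.univ.filter (fun A : Finset (Fin n) => k * A.card ≤ n),
        Real.exp (n * (y / k)) * (((k : ℝ) - 1)⁻¹ ^ A.card * 1 ^ (n - A.card)) :=
        Finset.sum_le_sum hterm
    _ ≤ ∑ A : Finset (Fin n),
        Real.exp (n * (y / k)) * (((k : ℝ) - 1)⁻¹ ^ A.card * 1 ^ (n - A.card)) := by
        apply Finset.sum_le_sum_of_subset_of_nonneg (Finset.subset_univ _)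
        intro A _ _
        positivity
    _ = Real.exp (n * (y / k)) * (((k : ℝ) - 1)⁻¹ + 1) ^ n := by
        rw [← Finset.mul_sum, Fin.sum_pow_mul_eq_add_pow]
    _ = _ := by
        have : ((k : ℝ) - 1)⁻¹ + 1 = Real.exp (Real.log ((k : ℝ) / ((k : ℝ) - 1))) := by
          rw [Real.exp_log (by positivity)]
          field_simp
          ring
        rw [this, ← Real.exp_nat_mul, ← Real.exp_add]
        congr 1
        ring

lemma SP_upper (n k : ℕ) (hk : 2 ≤ k) :
    (SP n k : ℝ) ≤ Real.exp (n * (Real.log ((k : ℝ) / ((k : ℝ) - 1)) +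
      Real.log ((k : ℝ) - 1) / (k : ℝ))) := by
  rw [← Nat.le_floor_iff (Real.exp_pos _).le]
  apply csSup_le
  · exact ⟨0, ∅, by simp, by simp, by simp⟩
  · rintro m ⟨Ps, h1, h2, rfl⟩
    rw [Nat.le_floor_iff (Real.exp_pos _).le]
    exact SP_upper_family n k hk Ps h1 h2

lemma SP_lower (k c : ℕ) (hk : 2 ≤ k) (hc : 1 ≤ c) :
    (c * k).choose c ≤ SP (c * k) k * k ^ 2 := by
  obtain ⟨Ps, h1, h2, h3⟩ := SP_exists_family k c hk hc
  refine h3.trans (Nat.mul_le_mul_right _ ?_)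
  apply le_csSup
  · refine ⟨⌊Real.exp ((c * k : ℕ) * (Real.log ((k : ℝ) / ((k : ℝ) - 1)) +
      Real.log ((k : ℝ) - 1) / (k : ℝ)))⌋₊, ?_⟩
    · rintro m ⟨Ps, h1, h2, rfl⟩
      exact Nat.le_floor (SP_upper_family _ k hk Ps h1 h2)
  · exact ⟨Ps, h1, h2, rfl⟩

lemma SP_lower_log (k c : ℕ) (hk : 2 ≤ k) (hc : 1 ≤ c) :
    (Real.log ((k : ℝ) / ((k : ℝ) - 1)) + Real.log ((k : ℝ) - 1) / (k : ℝ))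
      - (Real.log ((c * k : ℕ) + 1) / (c * k : ℕ) + Real.log (k ^ 2) / (c * k : ℕ))
      ≤ Real.log (SP (c * k) k) / (c * k : ℕ) := by
  have h1 := choose_term k c hk
  have h2 := SP_lower k c hk hc
  have hk' : (2 : ℝ) ≤ k := by exact_mod_cast hk
  have hk1 : (0 : ℝ) < (k : ℝ) - 1 := by linarith
  have hk0 : (0 : ℝ) < (k : ℝ) := by linarith
  have hc0 : (0 : ℝ) < (c : ℝ) := by exact_mod_cast hc
  have hcn : c ≤ c * k := by nlinarith
  have h3 : k ^ (c * k) ≤ (c * k + 1) * ((SP (c * k) k * k ^ 2) * (k - 1) ^ (c * k - c)) :=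
    h1.trans (by gcongr)
  have hSP : SP (c * k) k ≠ 0 := by
    intro h
    rw [h] at h2
    have := Nat.choose_pos hcn
    omega
  have h4 : (k : ℝ) ^ (c * k) ≤ (((c * k : ℕ) : ℝ) + 1) *
      (((SP (c * k) k : ℝ) * (k : ℝ) ^ 2) * ((k : ℝ) - 1) ^ (c * k - c)) := by
    have := (Nat.cast_le (α := ℝ)).2 h3
    push_cast [Nat.cast_sub (show 1 ≤ k by omega)] at this ⊢
    exact this
  have hS0 : (0 : ℝ) < SP (c * k) k := by exact_mod_cast Nat.pos_of_ne_zero hSP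
  have h5 := Real.log_le_log (by positivity) h4
  rw [Real.log_mul (by positivity) (by positivity), Real.log_mul (by positivity) (by positivity),
    Real.log_mul (by positivity) (by positivity), Real.log_pow (k : ℝ) (c * k), Real.log_pow ((k : ℝ) - 1) (c * k - c),
    Nat.cast_sub hcn] at h5
  have hn : (0 : ℝ) < ((c * k : ℕ) : ℝ) := by push_cast; positivity
  rw [Real.log_div hk0.ne' hk1.ne', sub_le_iff_le_add, ← add_div, ← add_div, le_div_iff₀ hn]
  have h6 : Real.log ((k : ℝ) - 1) / k * ((c * k : ℕ) : ℝ) = c * Real.log ((k : ℝ) - 1) := by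
    push_cast; field_simp
  rw [add_mul, h6]
  linarith

/-- For `k ≥ 2`,
`lim sup_{n→∞} (log SP(n,k))/n = log(k/(k−1)) + (log(k−1))/k`. -/
theorem SP_limsup (k : ℕ) (hk : 2 ≤ k) :
    limsup (fun n : ℕ => Real.log (SP n k) / n) atTop =
      Real.log ((k : ℝ) / ((k : ℝ) - 1)) + Real.log ((k : ℝ) - 1) / (k : ℝ) := by
  set L := Real.log ((k : ℝ) / ((k : ℝ) - 1)) + Real.log ((k : ℝ) - 1) / (k : ℝ) with hL
  have hub : ∀ᶠ n : ℕ in atTop, Real.log (SP n k) / n ≤ L := by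
    filter_upwards [eventually_ge_atTop 1] with n hn
    have hn0 : (0 : ℝ) < n := by exact_mod_cast hn
    have hk' : (2 : ℝ) ≤ k := by exact_mod_cast hk
    rw [div_le_iff₀ hn0]
    rcases Nat.eq_zero_or_pos (SP n k) with h | h
    · rw [h, Nat.cast_zero, Real.log_zero]
      refine mul_nonneg (add_nonneg (Real.log_nonneg ?_) (div_nonneg (Real.log_nonneg ?_) ?_)) hn0.le
      · rw [le_div_iff₀ (by linarith)]; linarith
      · linarith
      · linarith
    · have h0 : (0 : ℝ) < SP n k := by exact_mod_cast h
      rw [Real.log_le_iff_le_exp h0, mul_comm]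
      exact SP_upper n k hk
  have hbdd : IsBoundedUnder (· ≤ ·) atTop (fun n : ℕ => Real.log (SP n k) / n) := ⟨L, hub⟩
  have hbelow : IsBoundedUnder (· ≥ ·) atTop (fun n : ℕ => Real.log (SP n k) / n) :=
    isBoundedUnder_of ⟨0, (fun n => div_nonneg (Real.log_natCast_nonneg _) (Nat.cast_nonneg _))⟩
  apply le_antisymm
  · exact limsup_le_of_le hbelow.isCoboundedUnder_le hub
  · apply le_of_forall_lt
    intro a ha
    obtain ⟨b, hab, hb⟩ := exists_between ha
    refine lt_of_lt_of_le hab (le_limsup_of_frequently_le ?_ hbdd)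
    have hmul : Tendsto (fun c : ℕ => c * k) atTop atTop :=
      tendsto_id.atTop_mul_const' (by omega)
    have e1 : Tendsto (fun n : ℕ => Real.log ((n : ℝ) + 1) / n) atTop (nhds 0) := by
      have h := (Real.isLittleO_log_id_atTop.tendsto_div_nhds_zero.comp
        (tendsto_natCast_atTop_atTop (R := ℝ))).comp (tendsto_add_atTop_nat 1)
      have h' : Tendsto (fun n : ℕ => ((n : ℝ) + 1) / n) atTop (nhds 1) := by
        have := (tendsto_one_div_atTop_nhds_zero_nat (𝕜 := ℝ)).const_add 1
        rw [add_zero] at this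
        refine this.congr' ?_
        filter_upwards [eventually_ge_atTop 1] with n hn
        have hn0 : (0 : ℝ) < n := by exact_mod_cast hn
        field_simp
      have h2 := h.mul h'
      rw [zero_mul] at h2
      refine h2.congr ?_
      intro n
      simp only [Function.comp, id, Nat.cast_add, Nat.cast_one]
      have : (n : ℝ) + 1 ≠ 0 := by positivity
      field_simp
    have e2 : Tendsto (fun n : ℕ => Real.log ((k : ℝ) ^ 2) / n) atTop (nhds 0) :=
      tendsto_const_div_atTop_nhds_zero_nat _
    have e3 := (((e1.add e2).const_sub L).comp hmul)
    simp only [add_zero, sub_zero] at e3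
    have e4 := e3.eventually (lt_mem_nhds hb)
    have e5 : ∀ᶠ c : ℕ in atTop, b ≤ Real.log (SP (c * k) k) / (c * k : ℕ) := by
      filter_upwards [e4, eventually_ge_atTop 1] with c h hc
      exact h.le.trans (SP_lower_log k c hk hc)
    exact hmul.frequently e5.frequently
end

section
/- Let C be a covering array CA(n, r, k) with r ≥ 2. Then 2r ≤ C(⌊2n/k⌋, ⌊n/k⌋); in particular the maximum number of rows N(n,k) of a covering array with n columns over a k-alphabet satisfies N(n,k) ≤ (1/2)·C(⌊2n/k⌋, ⌊n/k⌋). -/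
theorem bollobas_aux {ι α : Type*} [DecidableEq ι] [DecidableEq α] (N : ℕ) :
    ∀ (X : Finset α) (s : Finset ι) (A B : ι → Finset α), X.card = N →
      (∀ i ∈ s, A i ⊆ X) → (∀ i ∈ s, B i ⊆ X) → (∀ i ∈ s, Disjoint (A i) (B i)) →
      (∀ i ∈ s, ∀ j ∈ s, i ≠ j → ¬ Disjoint (A i) (B j)) →
      ∑ i ∈ s, ((((A i).card + (B i).card).choose (A i).card : ℕ) : ℚ)⁻¹ ≤ 1 := by
  induction N with
  | zero =>
    intro X s A B hX hA hB hd hc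
    have hX0 : X = ∅ := Finset.card_eq_zero.mp hX
    subst hX0
    have hs : s.card ≤ 1 := by
      rw [Finset.card_le_one]
      intro i hi j hj
      by_contra hij
      apply hc i hi j hj hij
      rw [Finset.subset_empty.mp (hA i hi)]
      exact Finset.disjoint_empty_left _
    calc _ ≤ ∑ i ∈ s, (1 : ℚ) := by
          apply Finset.sum_le_sum
          intro i hi
          rw [Finset.subset_empty.mp (hA i hi), Finset.subset_empty.mp (hB i hi)]
          simp
      _ = s.card := by simp
      _ ≤ 1 := by exact_mod_cast hs
  | succ N ih =>
    intro X s A B hX hA hB hd hc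
    by_cases hne : ∃ i ∈ s, B i = ∅
    · obtain ⟨i, hi, hBi⟩ := hne
      have hs : s = {i} := by
        apply Finset.eq_singleton_iff_unique_mem.mpr
        refine ⟨hi, fun j hj => ?_⟩
        by_contra hij
        apply hc j hj i hi hij
        rw [hBi]
        exact Finset.disjoint_empty_right _
      subst hs
      simp [hBi]
    · push Not at hne
      have key : ∀ x ∈ X, ∑ i ∈ s, (if x ∈ A i then (0 : ℚ) else
          ((((A i).card + ((B i).erase x).card).choose (A i).card : ℕ) : ℚ)⁻¹) ≤ 1 := by
        intro x hx
        have h := ih (X.erase x) (s.filter (fun i => x ∉ A i)) A (fun i => (B i).erase x)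
          (by rw [Finset.card_erase_of_mem hx, hX]; rfl)
          (by
            intro i hi
            rw [Finset.mem_filter] at hi
            exact Finset.subset_erase.mpr ⟨hA i hi.1, hi.2⟩)
          (by
            intro i hi
            rw [Finset.mem_filter] at hi
            exact Finset.erase_subset_erase x (hB i hi.1))
          (by
            intro i hi
            rw [Finset.mem_filter] at hi
            exact (hd i hi.1).mono_right (Finset.erase_subset _ _))
          (by
            intro i hi j hj hij hdis
            rw [Finset.mem_filter] at hi hj
            apply hc i hi.1 j hj.1 hij
            rw [Finset.disjoint_left] at hdis ⊢
            intro y hy hyB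
            apply hdis hy
            rw [Finset.mem_erase]
            refine ⟨?_, hyB⟩
            rintro rfl
            exact hi.2 hy)
        rw [Finset.sum_filter] at h
        convert h using 2 with i hi
        split_ifs <;> simp_all
      have key2 := Finset.sum_le_sum key
      rw [Finset.sum_comm] at key2
      have per : ∀ i ∈ s, (X.card : ℚ) *
          ((((A i).card + (B i).card).choose (A i).card : ℕ) : ℚ)⁻¹ ≤
          ∑ x ∈ X, (if x ∈ A i then (0 : ℚ) else
          ((((A i).card + ((B i).erase x).card).choose (A i).card : ℕ) : ℚ)⁻¹) := by
        intro i hi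
        have hAB : A i ∪ B i ⊆ X := Finset.union_subset (hA i hi) (hB i hi)
        rw [← Finset.sum_sdiff hAB, Finset.sum_union (hd i hi)]
        have h1 : ∑ x ∈ X \ (A i ∪ B i), (if x ∈ A i then (0 : ℚ) else
            ((((A i).card + ((B i).erase x).card).choose (A i).card : ℕ) : ℚ)⁻¹) =
            ((X \ (A i ∪ B i)).card : ℚ) *
            ((((A i).card + (B i).card).choose (A i).card : ℕ) : ℚ)⁻¹ := by
          rw [← nsmul_eq_mul, ← Finset.sum_const]
          apply Finset.sum_congr rfl
          intro x hx
          simp only [Finset.mem_sdiff, Finset.mem_union, not_or] at hx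
          rw [if_neg hx.2.1, Finset.erase_eq_of_notMem hx.2.2]
        have h2 : ∑ x ∈ A i, (if x ∈ A i then (0 : ℚ) else
            ((((A i).card + ((B i).erase x).card).choose (A i).card : ℕ) : ℚ)⁻¹) = 0 := by
          apply Finset.sum_eq_zero
          intro x hx
          rw [if_pos hx]
        have h3 : ∑ x ∈ B i, (if x ∈ A i then (0 : ℚ) else
            ((((A i).card + ((B i).erase x).card).choose (A i).card : ℕ) : ℚ)⁻¹) =
            ((B i).card : ℚ) *
            ((((A i).card + ((B i).card - 1)).choose (A i).card : ℕ) : ℚ)⁻¹ := by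
          rw [← nsmul_eq_mul, ← Finset.sum_const]
          apply Finset.sum_congr rfl
          intro x hx
          rw [if_neg (Finset.disjoint_right.mp (hd i hi) hx), Finset.card_erase_of_mem hx]
        rw [h1, h2, h3]
        have hXc : X.card = (X \ (A i ∪ B i)).card + ((A i).card + (B i).card) := by
          rw [← Finset.card_union_of_disjoint (hd i hi), Finset.card_sdiff_add_card_eq_card hAB]
        have hb : 0 < (B i).card := Finset.card_pos.mpr (hne i hi)
        rw [hXc]
        obtain ⟨b, hb'⟩ : ∃ b, (B i).card = b + 1 := ⟨(B i).card - 1, by omega⟩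
        rw [hb']
        generalize (A i).card = a
        generalize (X \ (A i ∪ B i)).card = c
        have hch : ((a + b).choose a) * (a + b + 1) = (a + b + 1).choose a * (b + 1) := by
          have := Nat.choose_mul_succ_eq (a + b) a
          rw [this]
          congr 1
          omega
        have p1 : 0 < (a + b).choose a := Nat.choose_pos (by omega)
        have p2 : 0 < (a + b + 1).choose a := Nat.choose_pos (by omega)
        have e : a + (b + 1) = a + b + 1 := by omega
        rw [Nat.add_sub_cancel, e]
        generalize (a + b).choose a = u at *
        generalize (a + b + 1).choose a = v at *
        have hu : (0 : ℚ) < u := by exact_mod_cast p1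
        have hv : (0 : ℚ) < v := by exact_mod_cast p2
        have hq : (u : ℚ) * (a + b + 1) = v * (b + 1) := by exact_mod_cast hch
        have : ((a : ℚ) + b + 1) * (v : ℚ)⁻¹ = (b + 1) * (u : ℚ)⁻¹ := by
          field_simp
          linarith
        push_cast
        linarith
      have key3 := (Finset.sum_le_sum per).trans key2
      rw [← Finset.mul_sum] at key3
      have hXp : (0 : ℚ) < X.card := by rw [hX]; positivity
      simp only [Finset.sum_const, nsmul_eq_mul, mul_one] at key3
      by_contra hcon
      push Not at hcon
      nlinarith

theorem two_letters {n k : ℕ} (hk : 2 ≤ k) (u : Fin n → Fin k) :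
    ∃ p q : Fin k, p ≠ q ∧
      (Finset.univ.filter (fun c => u c = p)).card +
      (Finset.univ.filter (fun c => u c = q)).card ≤ 2 * n / k := by
  obtain ⟨m, rfl⟩ : ∃ m, k = m + 2 := ⟨k - 2, by omega⟩
  have hsum : ∑ p : Fin (m + 2), (Finset.univ.filter (fun c => u c = p)).card = n := by
    have := Finset.card_eq_sum_card_fiberwise (s := (Finset.univ : Finset (Fin n)))
      (t := (Finset.univ : Finset (Fin (m + 2)))) (f := u) (by intro x _; simp)
    simpa using this.symm
  have hsum2 : ∑ p : Fin (m + 2), (Finset.univ.filter (fun c => u c = p + 1)).card = n := by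
    refine Eq.trans ?_ hsum
    exact Equiv.sum_comp (Equiv.addRight (1 : Fin (m + 2)))
      (fun p => (Finset.univ.filter (fun c => u c = p)).card)
  by_contra hcon
  push Not at hcon
  have h : ∀ p ∈ (Finset.univ : Finset (Fin (m + 2))), 2 * n / (m + 2) + 1 ≤
      (Finset.univ.filter (fun c => u c = p)).card +
      (Finset.univ.filter (fun c => u c = p + 1)).card := by
    intro p _
    exact hcon p (p + 1) (by simp)
  have h' := Finset.sum_le_sum h
  rw [Finset.sum_const, Finset.sum_add_distrib, hsum, hsum2] at h'
  simp only [Finset.card_univ, Fintype.card_fin, smul_eq_mul] at h'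
  have := Nat.lt_mul_div_succ (2 * n) (show 0 < m + 2 by omega)
  omega


/-- Two vectors over `Fin k` are qualitatively independent if every ordered
pair of letters occurs in some coordinate. -/
def QIVec {n k : ℕ} (u v : Fin n → Fin k) : Prop :=
  ∀ a b : Fin k, ∃ i, u i = a ∧ v i = b

/-- If `C` is a covering array `CA(n, r, k)` with `r ≥ 2` (and `k ≥ 2`), then
`2r ≤ C(⌊2n/k⌋, ⌊n/k⌋)`; in particular the maximum number of rows of a covering
array with `n` columns over a `k`-alphabet is at most `(1/2)·C(⌊2n/k⌋, ⌊n/k⌋)`. -/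
theorem CA_rows_bound (n r k : ℕ) (hr : 2 ≤ r) (hk : 2 ≤ k)
    (C : Fin r → Fin n → Fin k)
    (hC : ∀ i j, i ≠ j → QIVec (C i) (C j)) :
    2 * r ≤ (2 * n / k).choose (n / k) ∧ r ≤ (2 * n / k).choose (n / k) / 2 := by

  have main : 2 * r ≤ (2 * n / k).choose (n / k) := by
    choose p q hpq hcard using fun i => two_letters hk (C i)
    let S : Fin r → Fin k → Finset (Fin n) := fun i a => Finset.univ.filter (fun c => C i c = a)
    have hS : ∀ i a c, c ∈ S i a ↔ C i c = a := by intro i a c; simp [S]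
    have hdisj : ∀ i a b, a ≠ b → Disjoint (S i a) (S i b) := by
      intro i a b hab
      rw [Finset.disjoint_left]
      intro c h1 h2
      rw [hS] at h1 h2
      exact hab (h1.symm.trans h2)
    have hcross : ∀ i j a b, i ≠ j → ¬ Disjoint (S i a) (S j b) := by
      intro i j a b hij hd
      obtain ⟨c, h1, h2⟩ := hC i j hij a b
      exact Finset.disjoint_left.mp hd ((hS i a c).mpr h1) ((hS j b c).mpr h2)
    have hself : ∀ i a, ¬ Disjoint (S i a) (S i a) := by
      intro i a hd
      have : ∃ j : Fin r, i ≠ j := by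
        have : Nontrivial (Fin r) := Fin.nontrivial_iff_two_le.mpr hr
        obtain ⟨j, hj⟩ := exists_ne i
        exact ⟨j, hj.symm⟩
      obtain ⟨j, hij⟩ := this
      obtain ⟨c, h1, -⟩ := hC i j hij a a
      exact Finset.disjoint_left.mp hd ((hS i a c).mpr h1) ((hS i a c).mpr h1)
    have hb := bollobas_aux n (Finset.univ : Finset (Fin n))
      (Finset.univ : Finset (Fin r × Bool))
      (fun x => S x.1 (if x.2 then p x.1 else q x.1))
      (fun x => S x.1 (if x.2 then q x.1 else p x.1))
      (by simp) (by simp) (by simp)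
      (by
        rintro ⟨i, t⟩ -
        cases t
        · exact hdisj i _ _ (hpq i).symm
        · exact hdisj i _ _ (hpq i))
      (by
        rintro ⟨i, t⟩ - ⟨j, t'⟩ - hne
        by_cases hij : i = j
        · subst hij
          cases t <;> cases t'
          · exact absurd rfl hne
          · exact hself i _
          · exact hself i _
          · exact absurd rfl hne
        · exact hcross i j _ _ hij)
    have hhalf : 2 * n / k / 2 = n / k := by
      rw [Nat.div_div_eq_div_mul, mul_comm k 2]
      exact Nat.mul_div_mul_left n k (by norm_num)
    have hle : ∀ a b : ℕ, a + b ≤ 2 * n / k →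
        (((2 * n / k).choose (n / k) : ℕ) : ℚ)⁻¹ ≤ (((a + b).choose a : ℕ) : ℚ)⁻¹ := by
      intro a b hab
      have p1 : 0 < (a + b).choose a := Nat.choose_pos (by omega)
      have h1 : (a + b).choose a ≤ (2 * n / k).choose (n / k) :=
        (Nat.choose_le_choose a hab).trans (hhalf ▸ Nat.choose_le_middle a (2 * n / k))
      apply inv_anti₀
      · exact_mod_cast p1
      · exact_mod_cast h1
    have hlow := Finset.sum_le_sum (s := (Finset.univ : Finset (Fin r × Bool)))
      (f := fun _ => (((2 * n / k).choose (n / k) : ℕ) : ℚ)⁻¹) (fun x _ => hle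
        (S x.1 (if x.2 then p x.1 else q x.1)).card (S x.1 (if x.2 then q x.1 else p x.1)).card
        (by
          obtain ⟨i, t⟩ := x
          have := hcard i
          cases t
          · simpa [S, add_comm] using this
          · simpa [S] using this))
    have hfin := hlow.trans hb
    simp only [Finset.sum_const, Finset.card_univ, Fintype.card_prod, Fintype.card_fin,
      Fintype.card_bool, nsmul_eq_mul] at hfin
    have hpos : 0 < (2 * n / k).choose (n / k) := by
      apply Nat.choose_pos
      rw [← hhalf]
      exact Nat.div_le_self _ _
    have hposq : (0 : ℚ) < (((2 * n / k).choose (n / k) : ℕ) : ℚ) := by exact_mod_cast hpos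
    rw [← div_eq_mul_inv, div_le_one hposq] at hfin
    have : r * 2 ≤ (2 * n / k).choose (n / k) := by exact_mod_cast hfin
    omega
  exact ⟨main, by omega⟩
end
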